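/- Let Ω ⊂ ℝ² be a bounded, open, simply connected domain satisfying Assumption (R), and let ψ₀ be the scalar potential of B. Assume ψ_min := inf_Ω ψ₀ < 0 < sup_Ω ψ₀ =: ψ_max. Assume further that either ψ₀⁻¹(ψ_max) contains a C^{2,α} closed simple curve enclosing a nonempty part of ψ₀⁻¹(ψ_min), or ψ₀⁻¹(ψ_min) contains a C^{2,α} closed simple curve enclosing a nonempty part of ψ₀⁻¹(ψ_max). Then lim_{h→0⁺} h·log Λ^D(h,B,Ω) = −2·Osc_Ω ψ₀, where Osc_Ω ψ₀ := ψ_max − ψ_min. -/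

import Mathlib

open MeasureTheory Set Filter Topology

noncomputable section

/-- First partial derivative (in the direction `x₁`) of a function on `ℝ × ℝ`. -/
def pd1 {E : Type*} [NormedAddCommGroup E] [NormedSpace ℝ E] (u : ℝ × ℝ → E) (x : ℝ × ℝ) : E :=
  fderiv ℝ u x (1, 0)

/-- Second partial derivative (in the direction `x₂`) of a function on `ℝ × ℝ`. -/
def pd2 {E : Type*} [NormedAddCommGroup E] [NormedSpace ℝ E] (u : ℝ × ℝ → E) (x : ℝ × ℝ) : E :=
  fderiv ℝ u x (0, 1)

/-- The Laplacian on `ℝ × ℝ`. -/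
def lap (ψ : ℝ × ℝ → ℝ) (x : ℝ × ℝ) : ℝ := pd1 (pd1 ψ) x + pd2 (pd2 ψ) x

/-- Test functions for the Dirichlet variational problems on `Ω`:
nonzero smooth compactly supported functions with support in `Ω`. -/
def IsTestFun (Ω : Set (ℝ × ℝ)) (u : ℝ × ℝ → ℂ) : Prop :=
  ContDiff ℝ (⊤ : ℕ∞) u ∧ HasCompactSupport u ∧ tsupport u ⊆ Ω ∧ u ≠ 0

/-- Rayleigh quotient of the spin-`σ` (`σ = -1` : spin-down, `σ = 1` : spin-up)
Dirichlet Pauli operator at the test function `u`. -/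
def pauliRayleigh (σ : ℝ) (h : ℝ) (A : ℝ × ℝ → ℝ × ℝ) (B : ℝ × ℝ → ℝ) (Ω : Set (ℝ × ℝ))
    (u : ℝ × ℝ → ℂ) : ℝ :=
  ((∫ x in Ω, (‖(h : ℂ) * pd1 u x - Complex.I * ((A x).1 : ℂ) * u x‖ ^ 2
      + ‖(h : ℂ) * pd2 u x - Complex.I * ((A x).2 : ℂ) * u x‖ ^ 2))
    + σ * (h * ∫ x in Ω, B x * ‖u x‖ ^ 2)) / ∫ x in Ω, ‖u x‖ ^ 2

/-- The ground state energy `λ₋^D(h,A,B,Ω)` of the spin-down Dirichlet Pauli operator. -/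
def lambdaMinusD (h : ℝ) (A : ℝ × ℝ → ℝ × ℝ) (B : ℝ × ℝ → ℝ) (Ω : Set (ℝ × ℝ)) : ℝ :=
  sInf (pauliRayleigh (-1) h A B Ω '' {u | IsTestFun Ω u})

/-- The ground state energy `λ₊^D(h,A,B,Ω)` of the spin-up Dirichlet Pauli operator. -/
def lambdaPlusD (h : ℝ) (A : ℝ × ℝ → ℝ × ℝ) (B : ℝ × ℝ → ℝ) (Ω : Set (ℝ × ℝ)) : ℝ :=
  sInf (pauliRayleigh 1 h A B Ω '' {u | IsTestFun Ω u})

/-- The ground state energy `Λ^D(h,A,B,Ω)` of the full Dirichlet Pauli operator. -/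
def LambdaD (h : ℝ) (A : ℝ × ℝ → ℝ × ℝ) (B : ℝ × ℝ → ℝ) (Ω : Set (ℝ × ℝ)) : ℝ :=
  min (lambdaMinusD h A B Ω) (lambdaPlusD h A B Ω)

/-- The canonical vector potential `∇⊥ψ = (−∂₂ψ, ∂₁ψ)`. -/
def perpGrad (ψ : ℝ × ℝ → ℝ) (x : ℝ × ℝ) : ℝ × ℝ := (-(pd2 ψ x), pd1 ψ x)

/-- `ψ` is the scalar potential of `B` on `Ω`: `ψ ∈ C⁰(closure Ω) ∩ C²(Ω)`,
`Δψ = B` in `Ω` and `ψ = 0` on `∂Ω`. -/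
structure IsScalarPotential (Ω : Set (ℝ × ℝ)) (B : ℝ × ℝ → ℝ) (ψ : ℝ × ℝ → ℝ) : Prop where
  contOn : ContinuousOn ψ (closure Ω)
  c2 : ContDiffOn ℝ 2 ψ Ω
  lap_eq : ∀ x ∈ Ω, lap ψ x = B x
  bdry : ∀ x ∈ frontier Ω, ψ x = 0

/-- `A` is a continuous vector potential for `B` on `Ω`: `∂₁A₂ − ∂₂A₁ = B`. -/
def IsVectorPotential (Ω : Set (ℝ × ℝ)) (B : ℝ × ℝ → ℝ) (A : ℝ × ℝ → ℝ × ℝ) : Prop :=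
  ContinuousOn A Ω ∧ ∀ x ∈ Ω, pd1 (fun y => (A y).2) x - pd2 (fun y => (A y).1) x = B x

/-- `γ` is a regular curve of class `C^{2,α}` on the parameter set `s`. -/
def C2HolderOn (α : ℝ) (γ : ℝ → ℝ × ℝ) (s : Set ℝ) : Prop :=
  ContDiffOn ℝ 2 γ s ∧
  (∃ C : ℝ, ∀ x ∈ s, ∀ y ∈ s,
      ‖derivWithin (derivWithin γ s) s x - derivWithin (derivWithin γ s) s y‖ ≤ C * |x - y| ^ α) ∧
  ∀ x ∈ s, derivWithin γ s x ≠ 0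

/-- Near `p`, the set `Γ` is a regular curve of class `C^{2,α}`. -/
def IsLocallyC2CurveAt (α : ℝ) (Γ : Set (ℝ × ℝ)) (p : ℝ × ℝ) : Prop :=
  ∃ ε > 0, ∃ γ : ℝ → ℝ × ℝ, C2HolderOn α γ (Icc (-1) 1) ∧ γ 0 = p ∧
    Γ ∩ Metric.ball p ε = γ '' Ioo (-1) 1 ∩ Metric.ball p ε

/-- `Γ` is (locally) a regular curve of class `C^{2,α}`. -/
def IsC2HolderSet (α : ℝ) (Γ : Set (ℝ × ℝ)) : Prop := ∀ p ∈ Γ, IsLocallyC2CurveAt α Γ p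

/-- `Ω` has a corner at `p` formed by two `C^{2,α}` arcs, of aperture less than `π`
(near `p`, `Ω` is contained in a strictly convex open cone with vertex `p`). -/
def HasConvexCornerAt (Ω : Set (ℝ × ℝ)) (α : ℝ) (p : ℝ × ℝ) : Prop :=
  ∃ ε > 0, (∃ γ₁ γ₂ : ℝ → ℝ × ℝ, C2HolderOn α γ₁ (Icc 0 1) ∧ C2HolderOn α γ₂ (Icc 0 1) ∧
      γ₁ 0 = p ∧ γ₂ 0 = p ∧
      frontier Ω ∩ Metric.ball p ε = (γ₁ '' Ico 0 1 ∪ γ₂ '' Ico 0 1) ∩ Metric.ball p ε) ∧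
    ∃ w : ℝ × ℝ, ∃ c > 0, ∀ x ∈ Ω ∩ Metric.ball p ε,
      c * ‖x - p‖ ≤ (x - p).1 * w.1 + (x - p).2 * w.2

/-- `Ω` has a continuous boundary which is piecewise of class `C^{2,α}` for some `α > 0`,
with at most finitely many corners, each of aperture less than `π`. -/
def HasPiecewiseC2Boundary (Ω : Set (ℝ × ℝ)) : Prop :=
  ∃ α > 0, ∃ S : Finset (ℝ × ℝ), ↑S ⊆ frontier Ω ∧
    (∀ p ∈ frontier Ω \ (S : Set (ℝ × ℝ)), IsLocallyC2CurveAt α (frontier Ω) p) ∧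
    ∀ p ∈ S, HasConvexCornerAt Ω α p

/-- Assumption (R): `Ω` is bounded and open with continuous, piecewise `C^{2,α}` boundary
having finitely many corners of aperture `< π`, and `B` extends continuously to `closure Ω`. -/
structure AssumptionR (Ω : Set (ℝ × ℝ)) (B : ℝ × ℝ → ℝ) : Prop where
  isOpen : IsOpen Ω
  bounded : Bornology.IsBounded Ω
  bdryReg : HasPiecewiseC2Boundary Ω
  fieldCont : ContinuousOn B (closure Ω)

/-- The oscillation of `ψ` over `Ω`. -/
def osc (ψ : ℝ × ℝ → ℝ) (Ω : Set (ℝ × ℝ)) : ℝ := sSup (ψ '' Ω) - sInf (ψ '' Ω)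

/-- The region enclosed by `Γ`: the union of the bounded connected components of `Γᶜ`. -/
def curveInterior (Γ : Set (ℝ × ℝ)) : Set (ℝ × ℝ) :=
  {x | x ∉ Γ ∧ Bornology.IsBounded (connectedComponentIn Γᶜ x)}

/-- `Γ` is a simple closed curve of class `C^{2,α}`. -/
def IsC2ClosedCurve (α : ℝ) (Γ : Set (ℝ × ℝ)) : Prop :=
  ∃ γ : ℝ → ℝ × ℝ, Function.Periodic γ 1 ∧ C2HolderOn α γ (Icc 0 1) ∧
    InjOn γ (Ico 0 1) ∧ Γ = γ '' Icc 0 1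

/-- The ground state energy `λ^D(Ω)` of the Dirichlet Laplacian on `Ω`. -/
def dirichletGSE (Ω : Set (ℝ × ℝ)) : ℝ :=
  sInf ((fun u : ℝ × ℝ → ℝ =>
      (∫ x in Ω, (pd1 u x ^ 2 + pd2 u x ^ 2)) / ∫ x in Ω, u x ^ 2) ''
    {u | ContDiff ℝ (⊤ : ℕ∞) u ∧ HasCompactSupport u ∧ tsupport u ⊆ Ω ∧ u ≠ 0})

/-- The open disc of radius `R` centred at the origin (with the Euclidean distance). -/
def disc (R : ℝ) : Set (ℝ × ℝ) := {y : ℝ × ℝ | y.1 ^ 2 + y.2 ^ 2 < R ^ 2}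

end

/-- There is no continuous logarithm of a function which agrees with `z` near infinity. -/
theorem not_exists_exp_eq_of_eq_far {F : ℝ × ℝ → ℂ} (hF : Continuous F) (hF0 : ∀ x, F x ≠ 0)
    {p : ℝ × ℝ} {R : ℝ} (hR : 0 < R)
    (hFR : ∀ θ : ℝ, F (p + (R * Real.cos θ, R * Real.sin θ)) = R * Complex.exp (θ * Complex.I)) :
    False := by
  have hsc : IsSimplyConnected (univ : Set (ℝ × ℝ)) := by
    have := (convex_univ (𝕜 := ℝ) (E := ℝ × ℝ)).contractibleSpace univ_nonempty
    exact SimplyConnectedSpace.ofContractible _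
  obtain ⟨H, hHc, hH⟩ := Complex.exists_continuousOn_eqOn_exp_comp hsc isOpen_univ
    hF.continuousOn (by rintro ⟨x, -, hx⟩; exact hF0 x hx)
  rw [continuousOn_univ] at hHc
  set c : ℝ → ℝ × ℝ := fun θ => p + (R * Real.cos θ, R * Real.sin θ) with hc
  have hcc : Continuous c := by fun_prop
  set K : ℝ → ℂ := fun θ => (H (c θ) - θ * Complex.I - Real.log R) / (2 * Real.pi * Complex.I)
    with hK
  have hKc : Continuous K := by fun_prop
  have hpi : (2 * Real.pi * Complex.I : ℂ) ≠ 0 := Complex.two_pi_I_ne_zero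
  have hK_int : ∀ θ, ∃ n : ℤ, K θ = n := by
    intro θ
    have h1 : Complex.exp (H (c θ)) = Complex.exp (θ * Complex.I + Real.log R) := by
      rw [Complex.exp_add, ← Complex.ofReal_exp, Real.exp_log hR, mul_comm, ← hFR θ]
      exact hH (mem_univ _)
    obtain ⟨n, hn⟩ := Complex.exp_eq_exp_iff_exists_int.1 h1
    refine ⟨n, ?_⟩
    rw [hK]
    simp only
    rw [hn, div_eq_iff hpi]
    ring
  choose n hn using hK_int
  have hnc : Continuous fun θ => (n θ : ℝ) := by
    have : (fun θ => (n θ : ℝ)) = fun θ => (K θ).re := by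
      funext θ; rw [hn]; simp
    rw [this]; fun_prop
  have hnc' : Continuous n := Int.isClosedEmbedding_coe_real.isInducing.continuous_iff.2 hnc
  have hconst : n 0 = n (2 * Real.pi) :=
    PreconnectedSpace.constant inferInstance hnc'
  have hper : c (2 * Real.pi) = c 0 := by simp [hc]
  have h0 := hn 0
  have h1 := hn (2 * Real.pi)
  rw [← hconst, ← h0, hK] at h1
  simp only [hper] at h1
  rw [div_left_inj' hpi] at h1
  apply hpi
  simp only [Complex.ofReal_zero, Complex.ofReal_mul, Complex.ofReal_ofNat] at h1
  linear_combination -h1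

theorem frontier_connectedComponentIn_compl_subset {Γ : Set (ℝ × ℝ)} (hΓ : IsClosed Γ)
    (x : ℝ × ℝ) : frontier (connectedComponentIn Γᶜ x) ⊆ Γ := by
  intro y hy
  by_contra hyΓ
  have hUo : ∀ z, IsOpen (connectedComponentIn Γᶜ z) := fun z =>
    hΓ.isOpen_compl.connectedComponentIn
  rw [(hUo x).frontier_eq] at hy
  obtain ⟨z, hz1, hz2⟩ := mem_closure_iff.1 hy.1 _ (hUo y) (mem_connectedComponentIn hyΓ)
  apply hy.2
  rw [connectedComponentIn_eq hz2, ← connectedComponentIn_eq hz1]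
  exact mem_connectedComponentIn hyΓ

/-- A compact subset of a simply connected open planar set encloses no point outside the set. -/
theorem connectedComponentIn_compl_subset_of_isSimplyConnected {Ω Γ : Set (ℝ × ℝ)}
    (hΩ : IsOpen Ω) (hsc : IsSimplyConnected Ω) (hΓ : IsCompact Γ) (hΓΩ : Γ ⊆ Ω) {x₀ : ℝ × ℝ}
    (hb : Bornology.IsBounded (connectedComponentIn Γᶜ x₀)) :
    connectedComponentIn Γᶜ x₀ ⊆ Ω := by
  classical
  intro p hpU
  by_contra hpΩ
  set U := connectedComponentIn Γᶜ x₀ with hU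
  let e : ℝ × ℝ → ℂ := fun x => ((x.1 - p.1 : ℝ) : ℂ) + ((x.2 - p.2 : ℝ) : ℂ) * Complex.I
  have hec : Continuous e := by fun_prop
  have he0 : ∀ x, e x = 0 → x = p := by
    intro x hx
    have h1 := congrArg Complex.re hx
    have h2 := congrArg Complex.im hx
    simp [e] at h1 h2
    ext <;> linarith
  obtain ⟨L, hLc, hL⟩ := Complex.exists_continuousOn_eqOn_exp_comp hsc hΩ hec.continuousOn
    (by rintro ⟨x, hx, hx0⟩; exact hpΩ (he0 x hx0 ▸ hx))
  obtain ⟨G, hG⟩ := ContinuousMap.exists_restrict_eq hΓ.isClosed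
    ⟨Γ.domRestrict L, continuousOn_iff_continuous_domRestrict.mp (hLc.mono hΓΩ)⟩
  have hGL : ∀ x ∈ Γ, G x = L x := fun x hx => by
    simpa using congrArg (fun f => f ⟨x, hx⟩) hG
  let F : ℝ × ℝ → ℂ := fun x => if x ∈ U then Complex.exp (G x) else e x
  have hF : Continuous F := by
    refine Continuous.if ?_ (by fun_prop) hec
    intro a ha
    have haΓ := frontier_connectedComponentIn_compl_subset hΓ.isClosed x₀ ha
    rw [hGL a haΓ]
    exact hL (hΓΩ haΓ)
  have hF0 : ∀ x, F x ≠ 0 := by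
    intro x
    by_cases hx : x ∈ U
    · simp [F, hx]
    · simp only [F, hx, if_false]
      intro h0
      exact hx (he0 x h0 ▸ hpU)
  obtain ⟨R, hR0, hR⟩ : ∃ R : ℝ, 0 < R ∧ ∀ x ∈ U, ‖e x‖ < R := by
    obtain ⟨R, hR⟩ := (hb.isCompact_closure.image hec).isBounded.exists_norm_le
    refine ⟨max R 0 + 1, by positivity, fun x hx => ?_⟩
    have := hR _ (mem_image_of_mem e (subset_closure hx))
    linarith [le_max_left R 0]
  refine not_exists_exp_eq_of_eq_far hF hF0 (p := p) hR0 fun θ => ?_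
  have hee : e (p + (R * Real.cos θ, R * Real.sin θ)) = R * Complex.exp (θ * Complex.I) := by
    simp only [e, Prod.fst_add, Prod.snd_add, add_sub_cancel_left]
    rw [Complex.exp_mul_I]
    push_cast
    ring
  have hnot : p + (R * Real.cos θ, R * Real.sin θ) ∉ U := by
    intro h
    have := hR _ h
    rw [hee, norm_mul, Complex.norm_exp_ofReal_mul_I, Complex.norm_real, Real.norm_eq_abs,
      abs_of_pos hR0, mul_one] at this
    exact lt_irrefl _ this
  simp only [F, hnot, if_false, hee]

/-- Smooth compactly supported cutoffs in finite dimension, equal to `1` near a compact set. -/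
theorem exists_contDiff_cutoff {K U : Set (ℝ × ℝ)} (hK : IsCompact K) (hU : IsOpen U)
    (hKU : K ⊆ U) :
    ∃ χ : ℝ × ℝ → ℝ, ContDiff ℝ (⊤ : ℕ∞) χ ∧ HasCompactSupport χ ∧ tsupport χ ⊆ U ∧
      (∀ᶠ x in 𝓝ˢ K, χ x = 1) ∧ ∀ x, χ x ∈ Icc (0 : ℝ) 1 := by
  obtain ⟨V, hVo, hKV, hVU, hVc⟩ := exists_open_between_and_isCompact_closure hK hU hKU
  obtain ⟨f, hf1, hf0, hf⟩ := exists_contMDiffMap_one_nhds_of_subset_interior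
    (n := (⊤ : ℕ∞)) (modelWithCornersSelf ℝ (ℝ × ℝ)) (s := K) (t := V) hK.isClosed
    (by rwa [hVo.interior_eq])
  have hs : tsupport f ⊆ closure V := closure_mono fun x hx => by
    by_contra h
    exact hx (hf0 x h)
  exact ⟨f, f.contMDiff.contDiff, hVc.of_isClosed_subset (isClosed_tsupport _) hs,
    hs.trans hVU, hf1, hf⟩

theorem integral_fderiv_apply_eq_zero {f : ℝ × ℝ → ℝ} (hf : ContDiff ℝ 1 f)
    (hc : HasCompactSupport f) (v : ℝ × ℝ) : ∫ x, fderiv ℝ f x v = 0 := by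
  have hcont : Continuous fun x => fderiv ℝ f x v :=
    (hf.continuous_fderiv one_ne_zero).clm_apply continuous_const
  have h := integral_mul_fderiv_eq_neg_fderiv_mul_of_integrable (μ := volume)
    (f := fun _ : ℝ × ℝ => (1 : ℝ)) (g := f) (v := v) (by simp)
    (by simpa using hcont.integrable_of_hasCompactSupport (hc.fderiv_apply ℝ v))
    (by simpa using hf.continuous.integrable_of_hasCompactSupport hc)
    (fun x _ => by fun_prop) (fun x _ => hf.differentiable one_ne_zero x)
  simpa using h

theorem fderiv_mul_apply_real {f g : ℝ × ℝ → ℝ} {x : ℝ × ℝ} (hf : DifferentiableAt ℝ f x)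
    (hg : DifferentiableAt ℝ g x) (v : ℝ × ℝ) :
    fderiv ℝ (fun y => f y * g y) x v = fderiv ℝ f x v * g x + f x * fderiv ℝ g x v := by
  rw [fderiv_fun_mul hf hg]
  simp
  ring

section PartialDerivatives

variable {E : Type*} [NormedAddCommGroup E] [NormedSpace ℝ E] {f : ℝ × ℝ → E}

theorem contDiff_pd1 {n m : WithTop ℕ∞} (hf : ContDiff ℝ n f) (hmn : m + 1 ≤ n) :
    ContDiff ℝ m (pd1 f) :=
  (hf.fderiv_right hmn).clm_apply contDiff_const

theorem contDiff_pd2 {n m : WithTop ℕ∞} (hf : ContDiff ℝ n f) (hmn : m + 1 ≤ n) :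
    ContDiff ℝ m (pd2 f) :=
  (hf.fderiv_right hmn).clm_apply contDiff_const

theorem continuous_pd1 (hf : ContDiff ℝ 1 f) : Continuous (pd1 f) :=
  (contDiff_pd1 (m := 0) hf (by simp)).continuous

theorem continuous_pd2 (hf : ContDiff ℝ 1 f) : Continuous (pd2 f) :=
  (contDiff_pd2 (m := 0) hf (by simp)).continuous

theorem pd1_eq_zero_of_notMem_tsupport {x : ℝ × ℝ} (hx : x ∉ tsupport f) : pd1 f x = 0 := by
  simp [pd1, fderiv_of_notMem_tsupport ℝ hx]

theorem pd2_eq_zero_of_notMem_tsupport {x : ℝ × ℝ} (hx : x ∉ tsupport f) : pd2 f x = 0 := by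
  simp [pd2, fderiv_of_notMem_tsupport ℝ hx]

theorem pd1_pd2_comm (hf : ContDiff ℝ 2 f) (x : ℝ × ℝ) : pd1 (pd2 f) x = pd2 (pd1 f) x := by
  have hd : DifferentiableAt ℝ (fderiv ℝ f) x :=
    (hf.fderiv_right (m := 1) (by norm_num)).differentiable one_ne_zero x
  have hs : IsSymmSndFDerivAt ℝ f x := hf.contDiffAt.isSymmSndFDerivAt (by simp)
  have key : ∀ v w : ℝ × ℝ,
      fderiv ℝ (fun y => fderiv ℝ f y v) x w = fderiv ℝ (fderiv ℝ f) x w v := by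
    intro v w
    rw [fderiv_clm_apply hd (differentiableAt_const v)]
    simp
  change fderiv ℝ (fun y => fderiv ℝ f y (0, 1)) x (1, 0)
    = fderiv ℝ (fun y => fderiv ℝ f y (1, 0)) x (0, 1)
  rw [key, key]
  exact hs _ _

end PartialDerivatives

theorem hasCompactSupport_of_eq_zero {E F : Type*} [Zero E] [Zero F] {f : ℝ × ℝ → E}
    {g : ℝ × ℝ → F} (hc : HasCompactSupport f) (h : ∀ x, x ∉ tsupport f → g x = 0) :
    HasCompactSupport g :=
  HasCompactSupport.intro hc h

theorem re_im_fderiv {u : ℝ × ℝ → ℂ} {x : ℝ × ℝ} (hu : DifferentiableAt ℝ u x) (v : ℝ × ℝ) :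
    fderiv ℝ u x v = ((fderiv ℝ (fun y => (u y).re) x v : ℝ) : ℂ)
      + ((fderiv ℝ (fun y => (u y).im) x v : ℝ) : ℂ) * Complex.I := by
  have h1 : fderiv ℝ (fun y => (u y).re) x = Complex.reCLM.comp (fderiv ℝ u x) :=
    (Complex.reCLM.hasFDerivAt.comp x hu.hasFDerivAt).fderiv
  have h2 : fderiv ℝ (fun y => (u y).im) x = Complex.imCLM.comp (fderiv ℝ u x) :=
    (Complex.imCLM.hasFDerivAt.comp x hu.hasFDerivAt).fderiv
  rw [h1, h2]
  simp [Complex.re_add_im]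

/-- The annihilation-type operator `h(∂₁ + i∂₂) + (∂₁ψ + i∂₂ψ)` factorizing the spin-down
Pauli operator. -/
noncomputable def dbarOp (h : ℝ) (ψ : ℝ × ℝ → ℝ) (u : ℝ × ℝ → ℂ) (x : ℝ × ℝ) : ℂ :=
  (h : ℂ) * (pd1 u x + Complex.I * pd2 u x) +
    (((pd1 ψ x : ℝ) : ℂ) + Complex.I * ((pd2 ψ x : ℝ) : ℂ)) * u x

theorem continuous_dbarOp {h : ℝ} {ψ : ℝ × ℝ → ℝ} {u : ℝ × ℝ → ℂ} (hψ : ContDiff ℝ 1 ψ)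
    (hu : ContDiff ℝ 1 u) : Continuous (dbarOp h ψ u) := by
  have := continuous_pd1 hu
  have := continuous_pd2 hu
  have := continuous_pd1 hψ
  have := continuous_pd2 hψ
  have := hu.continuous
  unfold dbarOp
  fun_prop

theorem dbarOp_eq_zero {h : ℝ} {ψ : ℝ × ℝ → ℝ} {u : ℝ × ℝ → ℂ} {x : ℝ × ℝ}
    (hx : x ∉ tsupport u) : dbarOp h ψ u x = 0 := by
  simp [dbarOp, pd1_eq_zero_of_notMem_tsupport hx, pd2_eq_zero_of_notMem_tsupport hx,
    image_eq_zero_of_notMem_tsupport hx]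

theorem integrable_of_tsupport {u : ℝ × ℝ → ℂ} (hc : HasCompactSupport u) {f : ℝ × ℝ → ℝ}
    (hf : Continuous f) (h : ∀ x, x ∉ tsupport u → f x = 0) : Integrable f :=
  hf.integrable_of_hasCompactSupport (hasCompactSupport_of_eq_zero hc h)

/-- Supersymmetric factorization of the spin-down Dirichlet Pauli form. -/
theorem integral_pauli_eq_integral_dbarOp (h : ℝ) {ψ : ℝ × ℝ → ℝ} {u : ℝ × ℝ → ℂ}
    (hψ : ContDiff ℝ 2 ψ) (hu : ContDiff ℝ 2 u) (hc : HasCompactSupport u) :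
    (∫ x, (‖(h : ℂ) * pd1 u x - Complex.I * ((perpGrad ψ x).1 : ℂ) * u x‖ ^ 2
      + ‖(h : ℂ) * pd2 u x - Complex.I * ((perpGrad ψ x).2 : ℂ) * u x‖ ^ 2))
      - h * ∫ x, lap ψ x * ‖u x‖ ^ 2 = ∫ x, ‖dbarOp h ψ u x‖ ^ 2 := by
  set a : ℝ × ℝ → ℝ := fun x => (u x).re with ha_def
  set b : ℝ × ℝ → ℝ := fun x => (u x).im with hb_def
  have ha : ContDiff ℝ 2 a := Complex.reCLM.contDiff.comp hu
  have hb : ContDiff ℝ 2 b := Complex.imCLM.contDiff.comp hu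
  have ha0 : ∀ x, x ∉ tsupport u → a x = 0 := fun x hx => by
    simp [ha_def, image_eq_zero_of_notMem_tsupport hx]
  have hb0 : ∀ x, x ∉ tsupport u → b x = 0 := fun x hx => by
    simp [hb_def, image_eq_zero_of_notMem_tsupport hx]
  have one_two : (1 : WithTop ℕ∞) + 1 ≤ 2 := by norm_num
  have ha1 := contDiff_pd1 (m := 1) ha one_two
  have ha2 := contDiff_pd2 (m := 1) ha one_two
  have hψ1 := contDiff_pd1 (m := 1) hψ one_two
  have hψ2 := contDiff_pd2 (m := 1) hψ one_two
  have hu1 : ContDiff ℝ 1 u := hu.of_le (by norm_num)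
  have ha' : ContDiff ℝ 1 a := ha.of_le (by norm_num)
  have hb' : ContDiff ℝ 1 b := hb.of_le (by norm_num)
  set N : ℝ × ℝ → ℝ := fun x => a x * a x + b x * b x with hN
  have hN1 : ContDiff ℝ 1 N := by fun_prop
  set P : ℝ × ℝ → ℝ := fun x => 2 * h ^ 2 * (b x * pd2 a x) + h * (pd1 ψ x * N x) with hP
  set Q : ℝ × ℝ → ℝ := fun x => -(2 * h ^ 2) * (b x * pd1 a x) + h * (pd2 ψ x * N x) with hQ
  have hP1 : ContDiff ℝ 1 P := by fun_prop
  have hQ1 : ContDiff ℝ 1 Q := by fun_prop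
  have hPc : HasCompactSupport P := hasCompactSupport_of_eq_zero hc fun x hx => by
    simp [hP, hN, ha0 x hx, hb0 x hx]
  have hQc : HasCompactSupport Q := hasCompactSupport_of_eq_zero hc fun x hx => by
    simp [hQ, hN, ha0 x hx, hb0 x hx]
  have dN : ∀ x v, fderiv ℝ N x v = 2 * (a x * fderiv ℝ a x v + b x * fderiv ℝ b x v) := by
    intro x v
    have h1 := ha'.differentiable one_ne_zero x
    have h2 := hb'.differentiable one_ne_zero x
    rw [hN, fderiv_fun_add (by fun_prop) (by fun_prop), add_apply,
      fderiv_mul_apply_real h1 h1, fderiv_mul_apply_real h2 h2]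
    ring
  have dP : ∀ x v, fderiv ℝ P x v = 2 * h ^ 2 * (fderiv ℝ b x v * pd2 a x
      + b x * fderiv ℝ (pd2 a) x v)
      + h * (fderiv ℝ (pd1 ψ) x v * N x + pd1 ψ x * fderiv ℝ N x v) := by
    intro x v
    have h1 := ha2.differentiable one_ne_zero x
    have h2 := hb'.differentiable one_ne_zero x
    have h3 := hψ1.differentiable one_ne_zero x
    have h4 := hN1.differentiable one_ne_zero x
    rw [hP, fderiv_fun_add (by fun_prop) (by fun_prop), add_apply,
      fderiv_const_mul (by fun_prop), fderiv_const_mul (by fun_prop),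
      smul_apply, smul_apply,
      fderiv_mul_apply_real h2 h1, fderiv_mul_apply_real h3 h4]
    simp
  have dQ : ∀ x v, fderiv ℝ Q x v = -(2 * h ^ 2) * (fderiv ℝ b x v * pd1 a x
      + b x * fderiv ℝ (pd1 a) x v)
      + h * (fderiv ℝ (pd2 ψ) x v * N x + pd2 ψ x * fderiv ℝ N x v) := by
    intro x v
    have h1 := ha1.differentiable one_ne_zero x
    have h2 := hb'.differentiable one_ne_zero x
    have h3 := hψ2.differentiable one_ne_zero x
    have h4 := hN1.differentiable one_ne_zero x
    rw [hQ, fderiv_fun_add (by fun_prop) (by fun_prop), add_apply,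
      fderiv_const_mul (by fun_prop), fderiv_const_mul (by fun_prop),
      smul_apply, smul_apply,
      fderiv_mul_apply_real h2 h1, fderiv_mul_apply_real h3 h4]
    simp
  have pointwise : ∀ x, (‖(h : ℂ) * pd1 u x - Complex.I * ((perpGrad ψ x).1 : ℂ) * u x‖ ^ 2
      + ‖(h : ℂ) * pd2 u x - Complex.I * ((perpGrad ψ x).2 : ℂ) * u x‖ ^ 2)
      - h * (lap ψ x * ‖u x‖ ^ 2) =
      ‖dbarOp h ψ u x‖ ^ 2 - fderiv ℝ P x (1, 0) - fderiv ℝ Q x (0, 1) := by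
    intro x
    rw [dP, dQ, dN, dN]
    have hcomm := pd1_pd2_comm ha x
    have hud := hu1.differentiable one_ne_zero x
    have e1 : pd1 u x = ((pd1 a x : ℝ) : ℂ) + ((pd1 b x : ℝ) : ℂ) * Complex.I :=
      re_im_fderiv hud _
    have e2 : pd2 u x = ((pd2 a x : ℝ) : ℂ) + ((pd2 b x : ℝ) : ℂ) * Complex.I :=
      re_im_fderiv hud _
    have e0 : u x = (a x : ℂ) + (b x : ℂ) * Complex.I := (Complex.re_add_im _).symm
    change _ = _ - (2 * h ^ 2 * (pd1 b x * pd2 a x + b x * pd1 (pd2 a) x)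
      + h * (pd1 (pd1 ψ) x * N x + pd1 ψ x * (2 * (a x * pd1 a x + b x * pd1 b x))))
      - (-(2 * h ^ 2) * (pd2 b x * pd1 a x + b x * pd2 (pd1 a) x)
      + h * (pd2 (pd2 ψ) x * N x + pd2 ψ x * (2 * (a x * pd2 a x + b x * pd2 b x))))
    rw [hcomm]
    simp only [dbarOp, perpGrad, e1, e2, e0, Complex.sq_norm, Complex.normSq_apply, hN, lap]
    simp
    ring
  have hlap : Continuous (lap ψ) := (continuous_pd1 hψ1).add (continuous_pd2 hψ2)
  have c1 := continuous_pd1 hu1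
  have c2 := continuous_pd2 hu1
  have c3 := hψ1.continuous
  have c4 := hψ2.continuous
  have c5 := hu.continuous
  have i1 : Integrable fun x => (‖(h : ℂ) * pd1 u x - Complex.I * ((perpGrad ψ x).1 : ℂ) * u x‖ ^ 2
      + ‖(h : ℂ) * pd2 u x - Complex.I * ((perpGrad ψ x).2 : ℂ) * u x‖ ^ 2) := by
    refine integrable_of_tsupport hc (by unfold perpGrad; fun_prop) fun x hx => ?_
    simp [pd1_eq_zero_of_notMem_tsupport hx, pd2_eq_zero_of_notMem_tsupport hx,
      image_eq_zero_of_notMem_tsupport hx]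
  have i2 : Integrable fun x => h * (lap ψ x * ‖u x‖ ^ 2) := by
    refine integrable_of_tsupport hc (by fun_prop) fun x hx => ?_
    simp [image_eq_zero_of_notMem_tsupport hx]
  have i3 : Integrable fun x => ‖dbarOp h ψ u x‖ ^ 2 := by
    have := continuous_dbarOp (h := h) (hψ.of_le (by norm_num : (1 : WithTop ℕ∞) ≤ 2)) hu1
    refine integrable_of_tsupport hc (by fun_prop) fun x hx => ?_
    simp [dbarOp_eq_zero hx]
  have i4 : Integrable fun x => fderiv ℝ P x (1, 0) :=
    ((hP1.continuous_fderiv one_ne_zero).clm_apply continuous_const).integrable_of_hasCompactSupport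
      (hPc.fderiv_apply ℝ _)
  have i5 : Integrable fun x => fderiv ℝ Q x (0, 1) :=
    ((hQ1.continuous_fderiv one_ne_zero).clm_apply continuous_const).integrable_of_hasCompactSupport
      (hQc.fderiv_apply ℝ _)
  rw [← integral_const_mul, ← integral_sub i1 i2, integral_congr_ae (.of_forall pointwise),
    integral_sub (f := fun x => ‖dbarOp h ψ u x‖ ^ 2 - fderiv ℝ P x (1, 0)) (i3.sub i4) i5,
    integral_sub i3 i4, integral_fderiv_apply_eq_zero hP1 hPc,
    integral_fderiv_apply_eq_zero hQ1 hQc, sub_zero, sub_zero]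

/-- Poincaré's inequality in a strip. -/
theorem integral_sq_le_integral_pd1_sq {v : ℝ × ℝ → ℂ} (hv : ContDiff ℝ 1 v)
    (hc : HasCompactSupport v) {R : ℝ} (hR : ∀ x ∈ tsupport v, |x.1| ≤ R) :
    ∫ x, ‖v x‖ ^ 2 ≤ 4 * R ^ 2 * ∫ x, ‖pd1 v x‖ ^ 2 := by
  set a : ℝ × ℝ → ℝ := fun x => (v x).re with ha_def
  set b : ℝ × ℝ → ℝ := fun x => (v x).im with hb_def
  have ha : ContDiff ℝ 1 a := Complex.reCLM.contDiff.comp hv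
  have hb : ContDiff ℝ 1 b := Complex.imCLM.contDiff.comp hv
  set P : ℝ × ℝ → ℝ := fun x => x.1 * (a x * a x + b x * b x) with hP
  have hP1 : ContDiff ℝ 1 P := by fun_prop
  have hPc : HasCompactSupport P := hasCompactSupport_of_eq_zero hc fun x hx => by
    simp [hP, ha_def, hb_def, image_eq_zero_of_notMem_tsupport hx]
  have dP : ∀ x, fderiv ℝ P x (1, 0) = (a x * a x + b x * b x)
      + x.1 * (2 * (a x * pd1 a x + b x * pd1 b x)) := by
    intro x
    have h1 := ha.differentiable one_ne_zero x
    have h2 := hb.differentiable one_ne_zero x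
    rw [hP, fderiv_mul_apply_real (by fun_prop) (by fun_prop),
      fderiv_fun_add (by fun_prop) (by fun_prop), add_apply,
      fderiv_mul_apply_real h1 h1, fderiv_mul_apply_real h2 h2, fderiv_fst]
    simp only [ContinuousLinearMap.coe_fst', pd1]
    ring
  have c1 := continuous_pd1 hv
  have c5 := hv.continuous
  have i1 : Integrable fun x => ‖v x‖ ^ 2 :=
    integrable_of_tsupport hc (by fun_prop) fun x hx => by
      simp [image_eq_zero_of_notMem_tsupport hx]
  have i2 : Integrable fun x => ‖pd1 v x‖ ^ 2 :=
    integrable_of_tsupport hc (by fun_prop) fun x hx => by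
      simp [pd1_eq_zero_of_notMem_tsupport hx]
  have i4 : Integrable fun x => fderiv ℝ P x (1, 0) :=
    ((hP1.continuous_fderiv one_ne_zero).clm_apply continuous_const).integrable_of_hasCompactSupport
      (hPc.fderiv_apply ℝ _)
  have pointwise : ∀ x, ‖v x‖ ^ 2 - 4 * R ^ 2 * ‖pd1 v x‖ ^ 2 ≤ 2 * fderiv ℝ P x (1, 0) := by
    intro x
    by_cases hx : x ∈ tsupport v
    · rw [dP]
      have e1 : pd1 v x = ((pd1 a x : ℝ) : ℂ) + ((pd1 b x : ℝ) : ℂ) * Complex.I :=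
        re_im_fderiv (hv.differentiable one_ne_zero x) _
      have e0 : v x = (a x : ℂ) + (b x : ℂ) * Complex.I := (Complex.re_add_im _).symm
      have hsq : x.1 ^ 2 ≤ R ^ 2 := sq_le_sq' (neg_le_of_abs_le (hR x hx)) (le_of_abs_le (hR x hx))
      rw [e1, e0]
      simp only [Complex.sq_norm, Complex.normSq_apply]
      simp
      nlinarith [sq_nonneg (a x + 2 * x.1 * pd1 a x), sq_nonneg (b x + 2 * x.1 * pd1 b x),
        mul_le_mul_of_nonneg_right hsq (add_nonneg (sq_nonneg (pd1 a x)) (sq_nonneg (pd1 b x)))]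
    · rw [dP]
      simp [image_eq_zero_of_notMem_tsupport hx, pd1_eq_zero_of_notMem_tsupport hx, ha_def, hb_def]
  have := integral_mono (i1.sub (i2.const_mul _)) (i4.const_mul 2) pointwise
  simp only [Pi.sub_apply] at this
  rw [integral_sub i1 (i2.const_mul _), integral_const_mul, integral_const_mul,
    integral_fderiv_apply_eq_zero hP1 hPc] at this
  linarith

theorem integral_sq_le_integral_dbar_sq {v : ℝ × ℝ → ℂ} (hv : ContDiff ℝ 2 v)
    (hc : HasCompactSupport v) {R : ℝ} (hR : ∀ x ∈ tsupport v, |x.1| ≤ R) :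
    ∫ x, ‖v x‖ ^ 2 ≤ 4 * R ^ 2 * ∫ x, ‖pd1 v x + Complex.I * pd2 v x‖ ^ 2 := by
  have hv1 : ContDiff ℝ 1 v := hv.of_le (by norm_num)
  refine (integral_sq_le_integral_pd1_sq hv1 hc hR).trans ?_
  have key := integral_pauli_eq_integral_dbarOp 1 (ψ := fun _ => 0) contDiff_const hv hc
  have p1 : pd1 (fun _ : ℝ × ℝ => (0 : ℝ)) = fun _ => 0 := by funext x; simp [pd1]
  have p2 : pd2 (fun _ : ℝ × ℝ => (0 : ℝ)) = fun _ => 0 := by funext x; simp [pd2]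
  simp only [dbarOp, perpGrad, lap, p1, p2] at key
  simp only [Complex.ofReal_one, one_mul, neg_zero, Complex.ofReal_zero, mul_zero, zero_mul,
    sub_zero, add_zero, integral_zero] at key
  rw [← key]
  have c1 := continuous_pd1 hv1
  have c2 := continuous_pd2 hv1
  gcongr ?_ * ?_
  refine integral_mono ?_ ?_ fun x => le_add_of_nonneg_right (by positivity)
  · exact integrable_of_tsupport hc (by fun_prop) fun x hx => by
      simp [pd1_eq_zero_of_notMem_tsupport hx]
  · exact integrable_of_tsupport hc (by fun_prop) fun x hx => by
      simp [pd1_eq_zero_of_notMem_tsupport hx, pd2_eq_zero_of_notMem_tsupport hx]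

theorem exists_contDiff_eqOn_nhdsSet {Ω K : Set (ℝ × ℝ)} {ψ : ℝ × ℝ → ℝ} (hΩ : IsOpen Ω)
    (hψ : ContDiffOn ℝ 2 ψ Ω) (hK : IsCompact K) (hKΩ : K ⊆ Ω) :
    ∃ φ : ℝ × ℝ → ℝ, ContDiff ℝ 2 φ ∧ ∀ᶠ x in 𝓝ˢ K, φ x = ψ x := by
  obtain ⟨χ, hχ, -, hχΩ, hχ1, -⟩ := exists_contDiff_cutoff hK hΩ hKΩ
  refine ⟨fun x => χ x * ψ x, ?_, hχ1.mono fun x hx => by simp [hx]⟩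
  rw [contDiff_iff_contDiffAt]
  intro x
  by_cases hx : x ∈ tsupport χ
  · exact (contDiff_infty.1 hχ 2).contDiffAt.mul
      (hψ.contDiffAt (hΩ.mem_nhds (hχΩ hx)))
  · have : (fun y => χ y * ψ y) =ᶠ[𝓝 x] fun _ => 0 := by
      filter_upwards [notMem_tsupport_iff_eventuallyEq.1 hx] with y hy
      simp [hy]
    exact contDiffAt_const.congr_of_eventuallyEq this

theorem Filter.EventuallyEq.pd1_eq {φ ψ : ℝ × ℝ → ℝ} {x : ℝ × ℝ} (h : φ =ᶠ[𝓝 x] ψ) :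
    pd1 φ x = pd1 ψ x := by
  simp [pd1, h.fderiv_eq]

theorem Filter.EventuallyEq.pd2_eq {φ ψ : ℝ × ℝ → ℝ} {x : ℝ × ℝ} (h : φ =ᶠ[𝓝 x] ψ) :
    pd2 φ x = pd2 ψ x := by
  simp [pd2, h.fderiv_eq]

theorem Filter.EventuallyEq.lap_eq {φ ψ : ℝ × ℝ → ℝ} {x : ℝ × ℝ} (h : φ =ᶠ[𝓝 x] ψ) :
    lap φ x = lap ψ x := by
  have h1 : pd1 φ =ᶠ[𝓝 x] pd1 ψ := h.eventuallyEq_nhds.mono fun _ hy => hy.pd1_eq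
  have h2 : pd2 φ =ᶠ[𝓝 x] pd2 ψ := h.eventuallyEq_nhds.mono fun _ hy => hy.pd2_eq
  rw [lap, lap, h1.pd1_eq, h2.pd2_eq]

theorem setIntegral_eq_integral_of_tsupport {Ω : Set (ℝ × ℝ)} {u : ℝ × ℝ → ℂ} (hu : tsupport u ⊆ Ω)
    {f : ℝ × ℝ → ℝ} (h : ∀ x, x ∉ tsupport u → f x = 0) : ∫ x in Ω, f x = ∫ x, f x :=
  setIntegral_eq_integral_of_forall_compl_eq_zero fun x hx => h x fun hxu => hx (hu hxu)

/-- The spin-down Rayleigh quotient in factorized form. -/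
theorem pauliRayleigh_neg_one_eq (h : ℝ) {Ω : Set (ℝ × ℝ)} {B ψ φ : ℝ × ℝ → ℝ} {u : ℝ × ℝ → ℂ}
    (hB : ∀ x ∈ Ω, lap ψ x = B x) (hφ : ContDiff ℝ 2 φ)
    (hφψ : ∀ᶠ x in 𝓝ˢ (tsupport u), φ x = ψ x)
    (hu : ContDiff ℝ 2 u) (hc : HasCompactSupport u) (huΩ : tsupport u ⊆ Ω) :
    pauliRayleigh (-1) h (perpGrad ψ) B Ω u
      = (∫ x, ‖dbarOp h φ u x‖ ^ 2) / ∫ x, ‖u x‖ ^ 2 := by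
  have hloc : ∀ x ∈ tsupport u, φ =ᶠ[𝓝 x] ψ := fun x hx => hφψ.filter_mono (nhds_le_nhdsSet hx)
  unfold pauliRayleigh
  rw [← integral_pauli_eq_integral_dbarOp h hφ hu hc]
  congr 1
  · rw [neg_one_mul, ← sub_eq_add_neg]
    congr 1
    · rw [setIntegral_eq_integral_of_tsupport huΩ]
      · refine integral_congr_ae (.of_forall fun x => ?_)
        by_cases hx : x ∈ tsupport u
        · simp only [perpGrad, (hloc x hx).pd1_eq, (hloc x hx).pd2_eq]
        · simp [image_eq_zero_of_notMem_tsupport hx]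
      · intro x hx
        simp [pd1_eq_zero_of_notMem_tsupport hx, pd2_eq_zero_of_notMem_tsupport hx,
          image_eq_zero_of_notMem_tsupport hx]
    · congr 1
      rw [setIntegral_eq_integral_of_tsupport huΩ]
      · refine integral_congr_ae (.of_forall fun x => ?_)
        by_cases hx : x ∈ tsupport u
        · simp only [(hloc x hx).lap_eq, hB x (huΩ hx)]
        · simp [image_eq_zero_of_notMem_tsupport hx]
      · intro x hx
        simp [image_eq_zero_of_notMem_tsupport hx]
  · rw [setIntegral_eq_integral_of_tsupport huΩ]
    intro x hx
    simp [image_eq_zero_of_notMem_tsupport hx]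

theorem dbarOp_exp_mul {h : ℝ} (hh : h ≠ 0) {ψ : ℝ × ℝ → ℝ} {v : ℝ × ℝ → ℂ} {x : ℝ × ℝ}
    (hψ : DifferentiableAt ℝ ψ x) (hv : DifferentiableAt ℝ v x) :
    dbarOp h ψ (fun y => (Real.exp (-ψ y / h) : ℂ) * v y) x
      = (Real.exp (-ψ x / h) : ℂ) * (h * (pd1 v x + Complex.I * pd2 v x)) := by
  have hE : HasFDerivAt (fun y => Real.exp (-ψ y / h))
      (Real.exp (-ψ x / h) • (h⁻¹ • -fderiv ℝ ψ x)) x := by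
    have := (hψ.hasFDerivAt.neg.mul_const h⁻¹).exp
    simpa only [div_eq_mul_inv, Pi.neg_apply] using this
  have hEc := (Complex.ofRealCLM.hasFDerivAt.comp x hE).mul hv.hasFDerivAt
  have hd : fderiv ℝ (fun y => (Real.exp (-ψ y / h) : ℂ) * v y) x = _ := hEc.fderiv
  have hhc : (h : ℂ) ≠ 0 := by exact_mod_cast hh
  simp only [dbarOp, pd1, pd2, hd]
  simp
  field_simp
  ring

theorem norm_sq_exp_mul (t : ℝ) (z : ℂ) :
    ‖(Real.exp t : ℂ) * z‖ ^ 2 = Real.exp (2 * t) * ‖z‖ ^ 2 := by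
  rw [norm_mul, mul_pow, Complex.norm_real, Real.norm_eq_abs, abs_of_pos (Real.exp_pos _),
    ← Real.exp_nat_mul]
  norm_num

theorem integral_norm_sq_pos {u : ℝ × ℝ → ℂ} (hu : Continuous u) (hc : HasCompactSupport u)
    (h0 : u ≠ 0) : 0 < ∫ x, ‖u x‖ ^ 2 := by
  obtain ⟨x, hx⟩ := Function.ne_iff.1 h0
  refine Continuous.integral_pos_of_hasCompactSupport_nonneg_nonzero (x := x) (by fun_prop)
    (hasCompactSupport_of_eq_zero hc fun y hy => by
      simp [image_eq_zero_of_notMem_tsupport hy]) (fun y => by positivity) ?_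
  simpa using hx

theorem contDiff_exp_mul {h : ℝ} {φ : ℝ × ℝ → ℝ} {u : ℝ × ℝ → ℂ} (hφ : ContDiff ℝ 2 φ)
    (hu : ContDiff ℝ 2 u) : ContDiff ℝ 2 fun x => (Real.exp (φ x / h) : ℂ) * u x :=
  (Complex.ofRealCLM.contDiff.comp (hφ.div_const h).exp).mul hu

/-- Lower bound for the factorized form in terms of the oscillation of the potential. -/
theorem exp_mul_integral_le_integral_dbarOp {h R m M : ℝ} (hh : 0 < h) {φ : ℝ × ℝ → ℝ}
    {u : ℝ × ℝ → ℂ} (hφ : ContDiff ℝ 2 φ) (hu : ContDiff ℝ 2 u) (hc : HasCompactSupport u)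
    (hR : ∀ x ∈ tsupport u, |x.1| ≤ R) (hm : ∀ x ∈ tsupport u, m ≤ φ x)
    (hM : ∀ x ∈ tsupport u, φ x ≤ M) :
    h ^ 2 * Real.exp (-(2 * (M - m)) / h) * ∫ x, ‖u x‖ ^ 2
      ≤ 4 * R ^ 2 * ∫ x, ‖dbarOp h φ u x‖ ^ 2 := by
  set v : ℝ × ℝ → ℂ := fun x => (Real.exp (φ x / h) : ℂ) * u x with hv
  have hv2 : ContDiff ℝ 2 v := contDiff_exp_mul hφ hu
  have hv1 : ContDiff ℝ 1 v := hv2.of_le (by norm_num)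
  have hφ1 : ContDiff ℝ 1 φ := hφ.of_le (by norm_num)
  have hu1 : ContDiff ℝ 1 u := hu.of_le (by norm_num)
  have hvu : tsupport v ⊆ tsupport u := closure_mono fun x hx => by
    simp only [hv, Function.mem_support, ne_eq, mul_eq_zero, not_or] at hx
    exact hx.2
  have hvc : HasCompactSupport v := hc.of_isClosed_subset (isClosed_tsupport _) hvu
  have huv : u = fun x => (Real.exp (-φ x / h) : ℂ) * v x := by
    funext x
    rw [hv]
    simp only
    rw [← mul_assoc, ← Complex.ofReal_mul, ← Real.exp_add]
    simp [neg_div]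
  have hpoin := integral_sq_le_integral_dbar_sq hv2 hvc (R := R) fun x hx => hR x (hvu hx)
  have hdbar : ∀ x, dbarOp h φ u x
      = (Real.exp (-φ x / h) : ℂ) * (h * (pd1 v x + Complex.I * pd2 v x)) := by
    intro x
    conv_lhs => rw [huv]
    exact dbarOp_exp_mul hh.ne' (hφ1.differentiable one_ne_zero x)
      (hv1.differentiable one_ne_zero x)
  have c1 := continuous_pd1 hv1
  have c2 := continuous_pd2 hv1
  have c3 := continuous_dbarOp (h := h) hφ1 hu1
  have c4 := hv1.continuous
  have c5 := hu1.continuous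
  have i1 : Integrable fun x => ‖pd1 v x + Complex.I * pd2 v x‖ ^ 2 :=
    integrable_of_tsupport hvc (by fun_prop) fun x hx => by
      simp [pd1_eq_zero_of_notMem_tsupport hx, pd2_eq_zero_of_notMem_tsupport hx]
  have i2 : Integrable fun x => ‖dbarOp h φ u x‖ ^ 2 :=
    integrable_of_tsupport hc (by fun_prop) fun x hx => by simp [dbarOp_eq_zero hx]
  have i3 : Integrable fun x => ‖u x‖ ^ 2 :=
    integrable_of_tsupport hc (by fun_prop) fun x hx => by
      simp [image_eq_zero_of_notMem_tsupport hx]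
  have i4 : Integrable fun x => ‖v x‖ ^ 2 :=
    integrable_of_tsupport hvc (by fun_prop) fun x hx => by
      simp [image_eq_zero_of_notMem_tsupport hx]
  have s1 : h ^ 2 * Real.exp (-(2 * M) / h) * ∫ x, ‖pd1 v x + Complex.I * pd2 v x‖ ^ 2
      ≤ ∫ x, ‖dbarOp h φ u x‖ ^ 2 := by
    rw [← integral_const_mul]
    refine integral_mono (i1.const_mul _) i2 fun x => ?_
    simp only
    by_cases hx : x ∈ tsupport u
    · rw [hdbar, norm_sq_exp_mul, norm_mul, mul_pow, Complex.norm_real, Real.norm_eq_abs, sq_abs]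
      have : Real.exp (-(2 * M) / h) ≤ Real.exp (2 * (-φ x / h)) := by
        apply Real.exp_le_exp.2
        rw [mul_div_assoc', div_le_div_iff_of_pos_right hh]
        linarith [hM x hx]
      calc _ = Real.exp (-(2 * M) / h) * (h ^ 2 * ‖pd1 v x + Complex.I * pd2 v x‖ ^ 2) := by ring
        _ ≤ _ := by gcongr
    · have hxv : x ∉ tsupport v := fun h' => hx (hvu h')
      simp [pd1_eq_zero_of_notMem_tsupport hxv, pd2_eq_zero_of_notMem_tsupport hxv]
  have s2 : Real.exp (2 * m / h) * ∫ x, ‖u x‖ ^ 2 ≤ ∫ x, ‖v x‖ ^ 2 := by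
    rw [← integral_const_mul]
    refine integral_mono (i3.const_mul _) i4 fun x => ?_
    simp only
    by_cases hx : x ∈ tsupport u
    · rw [hv]
      simp only
      rw [norm_sq_exp_mul]
      have : Real.exp (2 * m / h) ≤ Real.exp (2 * (φ x / h)) := by
        apply Real.exp_le_exp.2
        rw [mul_div_assoc', div_le_div_iff_of_pos_right hh]
        linarith [hm x hx]
      gcongr
    · simp [image_eq_zero_of_notMem_tsupport hx]
  have hexp : Real.exp (-(2 * (M - m)) / h)
      = Real.exp (-(2 * M) / h) * Real.exp (2 * m / h) := by
    rw [← Real.exp_add]; congr 1; ring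
  calc _ = h ^ 2 * Real.exp (-(2 * M) / h) * (Real.exp (2 * m / h) * ∫ x, ‖u x‖ ^ 2) := by
        rw [hexp]; ring
    _ ≤ h ^ 2 * Real.exp (-(2 * M) / h) *
        (4 * R ^ 2 * ∫ x, ‖pd1 v x + Complex.I * pd2 v x‖ ^ 2) := by
        exact mul_le_mul_of_nonneg_left (s2.trans hpoin) (by positivity)
    _ = 4 * R ^ 2 * (h ^ 2 * Real.exp (-(2 * M) / h) *
        ∫ x, ‖pd1 v x + Complex.I * pd2 v x‖ ^ 2) := by ring
    _ ≤ _ := by gcongr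

/-- Lower bound for the spin-down Rayleigh quotients. -/
theorem le_pauliRayleigh_neg_one {h R m M : ℝ} (hh : 0 < h) (hR0 : 0 < R) {Ω : Set (ℝ × ℝ)}
    {B ψ : ℝ × ℝ → ℝ} (hΩ : IsOpen Ω) (hψ : ContDiffOn ℝ 2 ψ Ω) (hB : ∀ x ∈ Ω, lap ψ x = B x)
    (hR : ∀ x ∈ Ω, |x.1| ≤ R) (hm : ∀ x ∈ Ω, m ≤ ψ x) (hM : ∀ x ∈ Ω, ψ x ≤ M)
    {u : ℝ × ℝ → ℂ} (hu : IsTestFun Ω u) :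
    h ^ 2 / (4 * R ^ 2) * Real.exp (-(2 * (M - m)) / h)
      ≤ pauliRayleigh (-1) h (perpGrad ψ) B Ω u := by
  obtain ⟨hus, hc, huΩ, hu0⟩ := hu
  obtain ⟨φ, hφ, hφψ⟩ := exists_contDiff_eqOn_nhdsSet hΩ hψ hc huΩ
  have hu2 : ContDiff ℝ 2 u := contDiff_infty.1 hus 2
  have heq : ∀ x ∈ tsupport u, φ x = ψ x := fun x hx => hφψ.self_of_nhdsSet x hx
  have key := exp_mul_integral_le_integral_dbarOp (R := R) (m := m) (M := M) hh hφ hu2 hc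
    (fun x hx => hR x (huΩ hx)) (fun x hx => heq x hx ▸ hm x (huΩ hx))
    (fun x hx => heq x hx ▸ hM x (huΩ hx))
  rw [pauliRayleigh_neg_one_eq h hB hφ hφψ hu2 hc huΩ,
    le_div_iff₀ (integral_norm_sq_pos hu2.continuous hc hu0), div_mul_eq_mul_div,
    div_mul_eq_mul_div, div_le_iff₀ (by positivity)]
  linarith

/-- A compactly supported `C¹` function is a `C¹`-uniform limit of smooth functions supported
in an arbitrarily small neighbourhood of its support. -/
theorem exists_contDiff_approx {u : ℝ × ℝ → ℂ} (hu : ContDiff ℝ 1 u) (hc : HasCompactSupport u)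
    {δ η : ℝ} (hδ : 0 < δ) (hη : 0 < η) :
    ∃ g : ℝ × ℝ → ℂ, ContDiff ℝ (⊤ : ℕ∞) g ∧ tsupport g ⊆ Metric.cthickening δ (tsupport u) ∧
      ∀ x, ‖g x - u x‖ ≤ η ∧ ‖pd1 g x - pd1 u x‖ ≤ η ∧ ‖pd2 g x - pd2 u x‖ ≤ η := by
  have huc : ∀ f : ℝ × ℝ → ℂ, Continuous f → (∀ x, x ∉ tsupport u → f x = 0) →
      ∃ ρ > 0, ∀ x y, dist x y < ρ → dist (f x) (f y) < η := fun f hf h =>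
    Metric.uniformContinuous_iff.1
      ((hasCompactSupport_of_eq_zero hc h).uniformContinuous_of_continuous hf) η hη
      |>.imp fun ρ hρ => ⟨hρ.1, fun x y hxy => hρ.2 hxy⟩
  obtain ⟨r₀, hr₀, h₀⟩ := huc u hu.continuous fun x hx => image_eq_zero_of_notMem_tsupport hx
  obtain ⟨r₁, hr₁, h₁⟩ := huc _ (continuous_pd1 hu) fun x hx => pd1_eq_zero_of_notMem_tsupport hx
  obtain ⟨r₂, hr₂, h₂⟩ := huc _ (continuous_pd2 hu) fun x hx => pd2_eq_zero_of_notMem_tsupport hx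
  obtain ⟨r, hr, hrr⟩ : ∃ r > 0, r ≤ δ ∧ r ≤ r₀ ∧ r ≤ r₁ ∧ r ≤ r₂ :=
    ⟨min δ (min r₀ (min r₁ r₂)), by positivity, by simp, by simp, by simp, by simp⟩
  let ρ : ContDiffBump (0 : ℝ × ℝ) := ⟨r / 2, r, by positivity, by linarith⟩
  let L := ContinuousLinearMap.lsmul ℝ ℝ (E := ℂ)
  have hρ : LocallyIntegrable (ρ.normed volume) := ρ.continuous_normed.locallyIntegrable
  have happrox : ∀ (f : ℝ × ℝ → ℂ) (s : ℝ), Continuous f → r ≤ s →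
      (∀ x y, dist x y < s → dist (f x) (f y) < η) → ∀ x,
      ‖convolution (ρ.normed volume) f L volume x - f x‖ ≤ η := by
    intro f s hf hs h x
    rw [← dist_eq_norm]
    exact ρ.dist_normed_convolution_le hf.aestronglyMeasurable fun y hy =>
      (h y x (lt_of_lt_of_le hy hs)).le
  have hd : ∀ x v, fderiv ℝ (convolution (ρ.normed volume) u L volume) x v
      = convolution (ρ.normed volume) (fun y => fderiv ℝ u y v) L volume x := by
    intro x v
    rw [(hc.hasFDerivAt_convolution_right L hρ hu x).fderiv]
    exact convolution_precompR_apply L hρ (hc.fderiv ℝ) (hu.continuous_fderiv one_ne_zero) x v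
  refine ⟨convolution (ρ.normed volume) u L volume, ?_, ?_, fun x => ⟨?_, ?_, ?_⟩⟩
  · exact ρ.hasCompactSupport_normed.contDiff_convolution_left L ρ.contDiff_normed
      hu.continuous.locallyIntegrable
  · refine closure_minimal (fun x hx => ?_) Metric.isClosed_cthickening
    obtain ⟨a, ha, b, hb, rfl⟩ := support_convolution_subset_swap L hx
    refine Metric.mem_cthickening_of_dist_le _ a δ _ (subset_tsupport u ha) ?_
    have : b ∈ Metric.ball 0 r := by simpa [ρ.support_normed_eq] using hb
    simp only [dist_self_add_left]
    exact (mem_ball_zero_iff.1 this).le.trans hrr.1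
  · exact happrox u r₀ hu.continuous hrr.2.1 h₀ x
  · rw [pd1, hd]; exact happrox _ r₁ (continuous_pd1 hu) hrr.2.2.1 h₁ x
  · rw [pd2, hd]; exact happrox _ r₂ (continuous_pd2 hu) hrr.2.2.2 h₂ x

/-- Compactly supported `C²` functions are admissible in the spin-down variational problem. -/
theorem lambdaMinusD_le_of_contDiff_two {h : ℝ} {Ω : Set (ℝ × ℝ)} {B ψ φ : ℝ × ℝ → ℝ}
    {u : ℝ × ℝ → ℂ} (hΩ : IsOpen Ω) (hB : ∀ x ∈ Ω, lap ψ x = B x)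
    (hbdd : BddBelow (pauliRayleigh (-1) h (perpGrad ψ) B Ω '' {u | IsTestFun Ω u}))
    (hφ : ContDiff ℝ 2 φ) (hφψ : ∀ᶠ x in 𝓝ˢ (tsupport u), φ x = ψ x)
    (hu : ContDiff ℝ 1 u) (hc : HasCompactSupport u) (huΩ : tsupport u ⊆ Ω) (hu0 : u ≠ 0) :
    lambdaMinusD h (perpGrad ψ) B Ω
      ≤ (∫ x, ‖dbarOp h φ u x‖ ^ 2) / ∫ x, ‖u x‖ ^ 2 := by
  obtain ⟨V, hV, hVu, hVφ⟩ := eventually_nhdsSet_iff_exists.1 hφψ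
  obtain ⟨δ, hδ, hδΩ⟩ := hc.exists_cthickening_subset_open (hΩ.inter hV) (subset_inter huΩ hVu)
  set K := Metric.cthickening δ (tsupport u) 
  have hK : IsCompact K := hc.cthickening
  have hη : ∀ n : ℕ, 0 < 1 / ((n : ℝ) + 1) := fun n => by positivity
  choose g hg hgK hgu using fun n : ℕ => exists_contDiff_approx hu hc hδ (hη n)
  have hlim : Tendsto (fun n : ℕ => 1 / ((n : ℝ) + 1)) atTop (𝓝 0) :=
    tendsto_one_div_add_atTop_nhds_zero_nat
  have t0 : ∀ x, Tendsto (fun n => g n x) atTop (𝓝 (u x)) := fun x =>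
    tendsto_iff_norm_sub_tendsto_zero.2 (squeeze_zero (fun _ => norm_nonneg _)
      (fun n => (hgu n x).1) hlim)
  have t1 : ∀ x, Tendsto (fun n => pd1 (g n) x) atTop (𝓝 (pd1 u x)) := fun x =>
    tendsto_iff_norm_sub_tendsto_zero.2 (squeeze_zero (fun _ => norm_nonneg _)
      (fun n => (hgu n x).2.1) hlim)
  have t2 : ∀ x, Tendsto (fun n => pd2 (g n) x) atTop (𝓝 (pd2 u x)) := fun x =>
    tendsto_iff_norm_sub_tendsto_zero.2 (squeeze_zero (fun _ => norm_nonneg _)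
      (fun n => (hgu n x).2.2) hlim)
  have hle : ∀ n x, ‖g n x‖ ≤ ‖u x‖ + 1 ∧ ‖pd1 (g n) x‖ ≤ ‖pd1 u x‖ + 1 ∧
      ‖pd2 (g n) x‖ ≤ ‖pd2 u x‖ + 1 := by
    intro n x
    have h1 : 1 / ((n : ℝ) + 1) ≤ 1 := by
      rw [div_le_one (by positivity)]; linarith [(Nat.cast_nonneg n : (0 : ℝ) ≤ n)]
    obtain ⟨a0, a1, a2⟩ := hgu n x
    exact ⟨by linarith [norm_sub_norm_le (g n x) (u x)],
      by linarith [norm_sub_norm_le (pd1 (g n) x) (pd1 u x)],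
      by linarith [norm_sub_norm_le (pd2 (g n) x) (pd2 u x)]⟩
  have hφ1 : ContDiff ℝ 1 φ := hφ.of_le (by norm_num)
  have cφ1 := continuous_pd1 hφ1
  have cφ2 := continuous_pd2 hφ1
  have cu1 := continuous_pd1 hu
  have cu2 := continuous_pd2 hu
  have cu := hu.continuous
  have hg1 : ∀ n, ContDiff ℝ 1 (g n) := fun n => contDiff_infty.1 (hg n) 1
  have hdom : ∀ f : ℝ × ℝ → ℝ, Continuous f → Integrable (K.indicator f) := fun f hf =>
    (hf.continuousOn.integrableOn_compact hK).integrable_indicator hK.measurableSet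
  have I0 : Tendsto (fun n => ∫ x, ‖g n x‖ ^ 2) atTop (𝓝 (∫ x, ‖u x‖ ^ 2)) := by
    refine tendsto_integral_of_dominated_convergence (K.indicator fun x => (‖u x‖ + 1) ^ 2)
      (fun n => ((hg1 n).continuous.norm.pow 2).aestronglyMeasurable) (hdom _ (by fun_prop))
      (fun n => .of_forall fun x => ?_) (.of_forall fun x => ((t0 x).norm.pow 2))
    by_cases hx : x ∈ K
    · rw [indicator_of_mem hx, Real.norm_of_nonneg (by positivity)]
      gcongr
      exact (hle n x).1
    · simp [hx, image_eq_zero_of_notMem_tsupport fun h' => hx (hgK n h')]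
  have I1 : Tendsto (fun n => ∫ x, ‖dbarOp h φ (g n) x‖ ^ 2) atTop
      (𝓝 (∫ x, ‖dbarOp h φ u x‖ ^ 2)) := by
    refine tendsto_integral_of_dominated_convergence (K.indicator fun x =>
        (|h| * ((‖pd1 u x‖ + 1) + (‖pd2 u x‖ + 1)) +
          (|pd1 φ x| + |pd2 φ x|) * (‖u x‖ + 1)) ^ 2)
      (fun n => ((continuous_dbarOp hφ1 (hg1 n)).norm.pow 2).aestronglyMeasurable)
      (hdom _ (by fun_prop))
      (fun n => .of_forall fun x => ?_) (.of_forall fun x => ?_)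
    · by_cases hx : x ∈ K
      · rw [indicator_of_mem hx, Real.norm_of_nonneg (by positivity)]
        obtain ⟨a0, a1, a2⟩ := hle n x
        have b1 : ‖pd1 (g n) x + Complex.I * pd2 (g n) x‖
            ≤ (‖pd1 u x‖ + 1) + (‖pd2 u x‖ + 1) := by
          refine (norm_add_le _ _).trans ?_
          rw [norm_mul, Complex.norm_I, one_mul]
          linarith
        have b2 : ‖((pd1 φ x : ℝ) : ℂ) + Complex.I * pd2 φ x‖ ≤ |pd1 φ x| + |pd2 φ x| := by
          refine (norm_add_le _ _).trans ?_
          rw [norm_mul, Complex.norm_I, one_mul, Complex.norm_real, Complex.norm_real]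
          rfl
        gcongr
        rw [dbarOp]
        refine (norm_add_le _ _).trans ?_
        rw [norm_mul, norm_mul, Complex.norm_real, Real.norm_eq_abs]
        gcongr
      · simp [hx, dbarOp_eq_zero fun h' => hx (hgK n h')]
    · exact ((((t1 x).add ((t2 x).const_mul Complex.I)).const_mul (h : ℂ)).add
        ((t0 x).const_mul _)).norm.pow 2
  have hpos := integral_norm_sq_pos cu hc hu0
  refine ge_of_tendsto (I1.div I0 hpos.ne') ?_
  filter_upwards [I0.eventually (lt_mem_nhds hpos)] with n hn
  have hgc : HasCompactSupport (g n) := hK.of_isClosed_subset (isClosed_tsupport _) (hgK n)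
  have hgΩ : tsupport (g n) ⊆ Ω := (hgK n).trans (hδΩ.trans inter_subset_left)
  have htest : IsTestFun Ω (g n) := by
    refine ⟨hg n, hgc, hgΩ, fun h0 => ?_⟩
    simp [h0] at hn
  have heq := pauliRayleigh_neg_one_eq h hB hφ (u := g n) (ψ := ψ) (eventually_nhdsSet_iff_exists.2
    ⟨V, hV, (hgK n).trans (hδΩ.trans inter_subset_right), hVφ⟩)
    (contDiff_infty.1 (hg n) 2) hgc hgΩ
  rw [Pi.div_apply, ← heq]
  exact csInf_le hbdd ⟨g n, htest, rfl⟩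

/-- Exponential upper bound for the spin-down energy, obtained from a cutoff in a well `U` of the
potential whose rim lies at height at least `s` and which reaches below height `t`. -/
theorem exists_lambdaMinusD_le {Ω K U : Set (ℝ × ℝ)} {B ψ : ℝ × ℝ → ℝ} {s t : ℝ} {x₀ : ℝ × ℝ}
    (hΩ : IsOpen Ω) (hψ : ContDiffOn ℝ 2 ψ Ω) (hB : ∀ x ∈ Ω, lap ψ x = B x)
    (hbdd : ∀ h > 0,
      BddBelow (pauliRayleigh (-1) h (perpGrad ψ) B Ω '' {u | IsTestFun Ω u}))
    (hK : IsCompact K) (hU : IsOpen U) (hKU : K ⊆ U) (hUΩ : U ⊆ Ω) (hx₀ : x₀ ∈ K)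
    (hs : ∀ x ∈ U \ K, s ≤ ψ x) (ht : ψ x₀ < t) :
    ∃ C > 0, ∀ h > 0,
      lambdaMinusD h (perpGrad ψ) B Ω ≤ C * h ^ 2 * Real.exp (-(2 * (s - t)) / h) := by
  obtain ⟨χ, hχ, hχc, hχU, hχ1, -⟩ := exists_contDiff_cutoff hK hU hKU
  obtain ⟨φ, hφ, hφψ⟩ := exists_contDiff_eqOn_nhdsSet hΩ hψ hχc (hχU.trans hUΩ)
  have hφχ : ∀ x ∈ tsupport χ, φ x = ψ x := fun x hx => hφψ.self_of_nhdsSet x hx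
  obtain ⟨V, hV, hKV, hVχ⟩ := eventually_nhdsSet_iff_exists.1 hχ1
  let v : ℝ × ℝ → ℂ := fun x => (χ x : ℂ)
  have hv : ContDiff ℝ 2 v := Complex.ofRealCLM.contDiff.comp (contDiff_infty.1 hχ 2)
  have hv1 : ContDiff ℝ 1 v := hv.of_le (by norm_num)
  have hvχ : tsupport v = tsupport χ := by
    simp only [tsupport, Function.support, v, ne_eq, Complex.ofReal_eq_zero]
  have hvc : HasCompactSupport v := by rwa [HasCompactSupport, hvχ]
  have hφ1 : ContDiff ℝ 1 φ := hφ.of_le (by norm_num)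
  let W : Set (ℝ × ℝ) := V ∩ {x | φ x < t}
  have hW : IsOpen W := hV.inter (isOpen_lt hφ.continuous continuous_const)
  have hWχ : W ⊆ tsupport χ := fun x hx => subset_tsupport χ (by simp [hVχ x hx.1])
  have hWfin : volume W ≠ ⊤ := ((measure_mono hWχ).trans_lt hχc.measure_lt_top).ne
  have hx₀V : x₀ ∈ V := hKV hx₀
  have hWpos : 0 < volume.real W := ENNReal.toReal_pos (hW.measure_pos volume
    ⟨x₀, hx₀V, by
      change φ x₀ < t
      rwa [hφχ x₀ (subset_tsupport χ (by simp [hVχ x₀ hx₀V]))]⟩).ne' hWfin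
  set N := ∫ x, ‖pd1 v x + Complex.I * pd2 v x‖ ^ 2 with hN
  have hN0 : 0 ≤ N := integral_nonneg fun x => by positivity
  have c1 := continuous_pd1 hv1
  have c2 := continuous_pd2 hv1
  have c3 := hφ.continuous
  have c4 := hv.continuous
  refine ⟨(N + 1) / volume.real W, by positivity, fun h hh => ?_⟩
  let u : ℝ × ℝ → ℂ := fun x => (Real.exp (-φ x / h) : ℂ) * v x
  have hu : ContDiff ℝ 2 u := contDiff_exp_mul hφ.neg hv
  have huv : tsupport u ⊆ tsupport v := closure_mono fun x hx => by
    simp only [u, Function.mem_support, ne_eq, mul_eq_zero, not_or] at hx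
    exact hx.2
  have huc : HasCompactSupport u := hvc.of_isClosed_subset (isClosed_tsupport _) huv
  have huχ : tsupport u ⊆ tsupport χ := huv.trans hvχ.le
  have hu0 : u ≠ 0 := fun h0 => by
    have := congrFun h0 x₀
    simp [u, v, hVχ x₀ hx₀V] at this
  have hden : Real.exp (-(2 * t) / h) * volume.real W ≤ ∫ x, ‖u x‖ ^ 2 := by
    have : ∫ x, W.indicator (fun _ => Real.exp (-(2 * t) / h)) x
        = Real.exp (-(2 * t) / h) * volume.real W := by
      rw [integral_indicator_const _ hW.measurableSet, smul_eq_mul, mul_comm]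
    rw [← this]
    refine integral_mono ((integrable_indicator_iff hW.measurableSet).2
      (integrableOn_const hWfin)) (integrable_of_tsupport huc (by fun_prop) fun x hx => by
      simp [image_eq_zero_of_notMem_tsupport hx]) fun x => ?_
    by_cases hx : x ∈ W
    · rw [indicator_of_mem hx]
      simp only [u, v, hVχ x hx.1, norm_sq_exp_mul]
      simp only [Complex.ofReal_one, norm_one, one_pow, mul_one]
      apply Real.exp_le_exp.2
      rw [mul_div_assoc', div_le_div_iff_of_pos_right hh]
      linarith [show φ x < t from hx.2]
    · rw [indicator_of_notMem hx]
      positivity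
  have hnum : ∫ x, ‖dbarOp h φ u x‖ ^ 2 ≤ h ^ 2 * Real.exp (-(2 * s) / h) * N := by
    rw [hN, ← integral_const_mul]
    refine integral_mono (integrable_of_tsupport huc
      ((continuous_dbarOp hφ1 (hu.of_le (by norm_num))).norm.pow 2) fun x hx => by
      simp [dbarOp_eq_zero hx]) ((integrable_of_tsupport hvc (by fun_prop) fun x hx => by
      simp [pd1_eq_zero_of_notMem_tsupport hx, pd2_eq_zero_of_notMem_tsupport hx]).const_mul _)
      fun x => ?_
    simp only
    rw [show dbarOp h φ u x = _ from dbarOp_exp_mul hh.ne' (hφ1.differentiable one_ne_zero x)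
      (hv1.differentiable one_ne_zero x), norm_sq_exp_mul, norm_mul, mul_pow, Complex.norm_real,
      Real.norm_eq_abs, sq_abs]
    by_cases hx : x ∈ tsupport χ ∧ x ∉ V
    · have hsx : s ≤ φ x := hφχ x hx.1 ▸ hs x ⟨hχU hx.1, fun h' => hx.2 (hKV h')⟩
      have : Real.exp (2 * (-φ x / h)) ≤ Real.exp (-(2 * s) / h) := by
        apply Real.exp_le_exp.2
        rw [mul_div_assoc', div_le_div_iff_of_pos_right hh]
        linarith
      calc _ ≤ Real.exp (-(2 * s) / h) * (h ^ 2 * ‖pd1 v x + Complex.I * pd2 v x‖ ^ 2) := by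
            gcongr
        _ = _ := by ring
    · have hv0 : fderiv ℝ v x = 0 := by
        rw [not_and_or, not_not] at hx
        rcases hx with hx | hx
        · exact fderiv_of_notMem_tsupport ℝ (hvχ ▸ hx)
        · have : v =ᶠ[𝓝 x] fun _ => 1 := by
            filter_upwards [hV.mem_nhds hx] with y hy
            simp [v, hVχ y hy]
          rw [this.fderiv_eq]
          simp
      simp [pd1, pd2, hv0]
  have hmain := lambdaMinusD_le_of_contDiff_two (h := h) hΩ hB (hbdd h hh) hφ
    (hφψ.filter_mono (nhdsSet_mono huχ)) (hu.of_le (by norm_num)) huc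
    (huχ.trans (hχU.trans hUΩ)) hu0
  refine hmain.trans ?_
  rw [div_le_iff₀ (integral_norm_sq_pos hu.continuous huc hu0)]
  have hexp : Real.exp (-(2 * (s - t)) / h) * Real.exp (-(2 * t) / h)
      = Real.exp (-(2 * s) / h) := by
    rw [← Real.exp_add]; congr 1; ring
  calc _ ≤ h ^ 2 * Real.exp (-(2 * s) / h) * N := hnum
    _ ≤ h ^ 2 * Real.exp (-(2 * s) / h) * (N + 1) := by gcongr; linarith
    _ = (N + 1) / volume.real W * h ^ 2 * Real.exp (-(2 * (s - t)) / h) *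
        (Real.exp (-(2 * t) / h) * volume.real W) := by
      rw [← hexp]; field_simp
    _ ≤ _ := by gcongr

theorem pd1_neg {E : Type*} [NormedAddCommGroup E] [NormedSpace ℝ E] (f : ℝ × ℝ → E) :
    pd1 (-f) = -pd1 f := by
  funext x; simp [pd1, fderiv_neg]

theorem pd2_neg {E : Type*} [NormedAddCommGroup E] [NormedSpace ℝ E] (f : ℝ × ℝ → E) :
    pd2 (-f) = -pd2 f := by
  funext x; simp [pd2, fderiv_neg]

theorem lap_neg (ψ : ℝ × ℝ → ℝ) (x : ℝ × ℝ) : lap (-ψ) x = -lap ψ x := by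
  simp [lap, pd1_neg, pd2_neg]; ring

theorem IsScalarPotential.neg {Ω : Set (ℝ × ℝ)} {B ψ : ℝ × ℝ → ℝ}
    (h : IsScalarPotential Ω B ψ) : IsScalarPotential Ω (-B) (-ψ) where
  contOn := h.contOn.neg
  c2 := h.c2.neg
  lap_eq x hx := by rw [lap_neg, h.lap_eq x hx, Pi.neg_apply]
  bdry x hx := by rw [Pi.neg_apply, h.bdry x hx, neg_zero]

theorem fderiv_conj (u : ℝ × ℝ → ℂ) (x v : ℝ × ℝ) :
    fderiv ℝ (fun y => star (u y)) x v = star (fderiv ℝ u x v) := by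
  have : fderiv ℝ (Complex.conjCLE ∘ u) x
      = (Complex.conjCLE : ℂ →L[ℝ] ℂ).comp (fderiv ℝ u x) := Complex.conjCLE.comp_fderiv
  exact congrArg (fun L => L v) this

theorem IsTestFun.conj {Ω : Set (ℝ × ℝ)} {u : ℝ × ℝ → ℂ} (hu : IsTestFun Ω u) :
    IsTestFun Ω fun x => star (u x) := by
  have hts : tsupport (fun x => star (u x)) = tsupport u := by
    simp only [tsupport, Function.support, ne_eq, star_eq_zero]
  refine ⟨Complex.conjCLE.contDiff.comp hu.1, ?_, hts ▸ hu.2.2.1, fun h => hu.2.2.2 ?_⟩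
  · rw [HasCompactSupport, hts]; exact hu.2.1
  · funext x
    exact star_eq_zero.1 (congrFun h x)

theorem pauliRayleigh_star (σ h : ℝ) (ψ B : ℝ × ℝ → ℝ) (Ω : Set (ℝ × ℝ)) (u : ℝ × ℝ → ℂ) :
    pauliRayleigh (-σ) h (perpGrad (-ψ)) (-B) Ω (fun x => star (u x))
      = pauliRayleigh σ h (perpGrad ψ) B Ω u := by
  have key : ∀ (a : ℝ) (z w : ℂ),
      ‖(h : ℂ) * star z - Complex.I * ((-a : ℝ) : ℂ) * star w‖
        = ‖(h : ℂ) * z - Complex.I * a * w‖ := by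
    intro a z w
    rw [← norm_star ((h : ℂ) * z - Complex.I * a * w)]
    congr 1
    simp [mul_comm]
  unfold pauliRayleigh
  have e : perpGrad (-ψ) = -perpGrad ψ := by
    funext x; simp [perpGrad, pd1_neg, pd2_neg]
  have p1 : ∀ x, pd1 (fun y => star (u y)) x = star (pd1 u x) := fun x => fderiv_conj u x _
  have p2 : ∀ x, pd2 (fun y => star (u y)) x = star (pd2 u x) := fun x => fderiv_conj u x _
  simp only [e, p1, p2, Pi.neg_apply, Prod.fst_neg, Prod.snd_neg, key, norm_star, neg_mul,
    integral_neg, mul_neg, neg_neg]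

theorem lambdaPlusD_eq_lambdaMinusD_neg (h : ℝ) (ψ B : ℝ × ℝ → ℝ) (Ω : Set (ℝ × ℝ)) :
    lambdaPlusD h (perpGrad ψ) B Ω = lambdaMinusD h (perpGrad (-ψ)) (-B) Ω := by
  unfold lambdaPlusD lambdaMinusD
  congr 1
  ext r
  constructor
  · rintro ⟨u, hu, rfl⟩
    exact ⟨_, IsTestFun.conj hu, pauliRayleigh_star 1 h ψ B Ω u⟩
  · rintro ⟨u, hu, rfl⟩
    refine ⟨_, IsTestFun.conj hu, ?_⟩
    have := pauliRayleigh_star (-1) h (-ψ) (-B) Ω u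
    rwa [neg_neg, neg_neg, neg_neg] at this

theorem LambdaD_neg (h : ℝ) (ψ B : ℝ × ℝ → ℝ) (Ω : Set (ℝ × ℝ)) :
    LambdaD h (perpGrad (-ψ)) (-B) Ω = LambdaD h (perpGrad ψ) B Ω := by
  rw [LambdaD, LambdaD, lambdaPlusD_eq_lambdaMinusD_neg h ψ, lambdaPlusD_eq_lambdaMinusD_neg,
    neg_neg, neg_neg, min_comm]

theorem exists_isTestFun {Ω : Set (ℝ × ℝ)} (hΩ : IsOpen Ω) {x₀ : ℝ × ℝ} (hx₀ : x₀ ∈ Ω) :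
    ∃ u, IsTestFun Ω u := by
  obtain ⟨χ, hχ, hχc, hχΩ, hχ1, -⟩ :=
    exists_contDiff_cutoff isCompact_singleton hΩ (singleton_subset_iff.2 hx₀)
  have hts : tsupport (fun x => (χ x : ℂ)) = tsupport χ := by
    simp only [tsupport, Function.support, ne_eq, Complex.ofReal_eq_zero]
  refine ⟨fun x => (χ x : ℂ), Complex.ofRealCLM.contDiff.comp hχ, ?_, hts ▸ hχΩ, fun h => ?_⟩
  · rwa [HasCompactSupport, hts]
  · have := congrFun h x₀
    simp [hχ1.self_of_nhdsSet x₀ rfl] at this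

/-- Squeeze argument in the semiclassical limit. -/
theorem tendsto_mul_log_of_exp_bounds {f : ℝ → ℝ} {D : ℝ}
    (hlow : ∃ c > 0, ∀ h > 0, c * h ^ 2 * Real.exp (-(2 * D) / h) ≤ f h)
    (hup : ∀ᶠ ε in 𝓝[>] (0 : ℝ), ∃ C > 0, ∀ h > 0,
      f h ≤ C * h ^ 2 * Real.exp (-(2 * (D - ε)) / h)) :
    Tendsto (fun h => h * Real.log (f h)) (𝓝[>] 0) (𝓝 (-(2 * D))) := by
  have hlim : ∀ c > 0, ∀ d : ℝ, Tendsto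
      (fun h => h * Real.log (c * h ^ 2 * Real.exp (-(2 * d) / h)))
      (𝓝[>] 0) (𝓝 (-(2 * d))) := by
    intro c hc d
    have h0 : Tendsto (fun h : ℝ => Real.log h * h) (𝓝[>] 0) (𝓝 0) := by
      simpa only [Real.rpow_one] using tendsto_log_mul_rpow_nhdsGT_zero zero_lt_one
    have h1 : Tendsto (fun h : ℝ => h * Real.log c + 2 * (Real.log h * h) - 2 * d) (𝓝[>] 0)
        (𝓝 (0 * Real.log c + 2 * 0 - 2 * d)) :=
      (((tendsto_id.mono_left nhdsWithin_le_nhds).mul_const _).add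
        (h0.const_mul 2)).sub_const _
    rw [show 0 * Real.log c + 2 * 0 - 2 * d = -(2 * d) by ring] at h1
    refine h1.congr' ?_
    filter_upwards [self_mem_nhdsWithin] with h hh
    have hh' : (0 : ℝ) < h := hh
    rw [Real.log_mul (by positivity) (Real.exp_ne_zero _), Real.log_mul hc.ne' (by positivity),
      Real.log_exp, Real.log_pow]
    field_simp
    push_cast
    ring
  obtain ⟨c, hc, hlow⟩ := hlow
  have hpos : ∀ h > 0, 0 < f h := fun h hh => lt_of_lt_of_le (by positivity) (hlow h hh)
  refine tendsto_order.2 ⟨fun a ha => ?_, fun b hb => ?_⟩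
  · filter_upwards [(hlim c hc D).eventually (lt_mem_nhds ha), self_mem_nhdsWithin] with h h1 hh
    have hh' : (0 : ℝ) < h := hh
    exact h1.trans_le (mul_le_mul_of_nonneg_left
      (Real.log_le_log (by positivity) (hlow h hh)) hh'.le)
  · have hsmall : ∀ᶠ ε in 𝓝[>] (0 : ℝ), ε < (b + 2 * D) / 2 :=
      nhdsWithin_le_nhds (gt_mem_nhds (by linarith))
    obtain ⟨ε, ⟨C, hC, hup⟩, hε⟩ := (hup.and hsmall).exists
    filter_upwards [(hlim C hC (D - ε)).eventually (gt_mem_nhds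
      (show -(2 * (D - ε)) < b by linarith)),
      self_mem_nhdsWithin] with h h1 hh
    have hh' : (0 : ℝ) < h := hh
    exact (mul_le_mul_of_nonneg_left (Real.log_le_log (hpos h hh) (hup h hh)) hh'.le).trans_lt h1

/-- The limit when the maximal level set encloses a minimum point. -/
theorem tendsto_log_LambdaD_of_maximal_level {Ω Γ : Set (ℝ × ℝ)} {B ψ : ℝ × ℝ → ℝ}
    (hΩ : IsOpen Ω) (hΩb : Bornology.IsBounded Ω) (hsc : IsSimplyConnected Ω)
    (hψ : IsScalarPotential Ω B ψ) (hmin : sInf (ψ '' Ω) < 0) (hmax : 0 < sSup (ψ '' Ω))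
    (hΓ : IsCompact Γ) (hΓM : Γ ⊆ closure Ω ∩ ψ ⁻¹' {sSup (ψ '' Ω)})
    (hne : (curveInterior Γ ∩ closure Ω ∩ ψ ⁻¹' {sInf (ψ '' Ω)}).Nonempty) :
    Tendsto (fun h : ℝ => h * Real.log (LambdaD h (perpGrad ψ) B Ω)) (𝓝[>] 0)
      (𝓝 (-(2 * osc ψ Ω))) := by
  set m := sInf (ψ '' Ω) with hm_def
  set M := sSup (ψ '' Ω) with hM_def
  obtain ⟨x₀, ⟨⟨hx₀Γ, hx₀b⟩, hx₀cl⟩, hx₀m⟩ := hne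
  have hmem : ∀ x ∈ closure Ω, ψ x ≠ 0 → x ∈ Ω := fun x hx h0 => by
    by_contra hxΩ
    exact h0 (hψ.bdry x ⟨hx, by rwa [hΩ.interior_eq]⟩)
  have hx₀ψ : ψ x₀ = m := hx₀m
  have hx₀ : x₀ ∈ Ω := hmem x₀ hx₀cl (by rw [hx₀ψ]; exact hmin.ne)
  have hΓψ : ∀ x ∈ Γ, ψ x = M := fun x hx => (hΓM hx).2
  have hΓΩ : Γ ⊆ Ω := fun x hx => hmem x (hΓM hx).1 (by rw [hΓψ x hx]; exact hmax.ne')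
  have hcomp : IsCompact (ψ '' closure Ω) := hΩb.isCompact_closure.image_of_continuousOn hψ.contOn
  have hb : Bornology.IsBounded (ψ '' Ω) := hcomp.isBounded.subset (image_mono subset_closure)
  have hm : ∀ x ∈ Ω, m ≤ ψ x := fun x hx => csInf_le hb.bddBelow (mem_image_of_mem ψ hx)
  have hM : ∀ x ∈ Ω, ψ x ≤ M := fun x hx => le_csSup hb.bddAbove (mem_image_of_mem ψ hx)
  obtain ⟨R, hR0, hR⟩ := hΩb.exists_pos_norm_le
  have hR' : ∀ x ∈ Ω, |x.1| ≤ R := fun x hx => (norm_fst_le x).trans (hR x hx)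
  obtain ⟨u₀, hu₀⟩ := exists_isTestFun hΩ hx₀
  have hlow : ∀ h > 0, ∀ u, IsTestFun Ω u →
      h ^ 2 / (4 * R ^ 2) * Real.exp (-(2 * (M - m)) / h)
        ≤ pauliRayleigh (-1) h (perpGrad ψ) B Ω u := fun h hh u hu =>
    le_pauliRayleigh_neg_one hh hR0 hΩ hψ.c2 hψ.lap_eq hR' hm hM hu
  have hbdd : ∀ h > 0,
      BddBelow (pauliRayleigh (-1) h (perpGrad ψ) B Ω '' {u | IsTestFun Ω u}) := fun h hh =>
    ⟨_, forall_mem_image.2 (hlow h hh)⟩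
  refine tendsto_mul_log_of_exp_bounds ⟨1 / (4 * R ^ 2), by positivity, fun h hh => ?_⟩ ?_
  · rw [one_div_mul_eq_div]
    refine le_min (le_csInf ⟨_, u₀, hu₀, rfl⟩ (forall_mem_image.2 (hlow h hh))) ?_
    rw [lambdaPlusD_eq_lambdaMinusD_neg]
    refine le_csInf ⟨_, u₀, hu₀, rfl⟩ (forall_mem_image.2 fun u hu => ?_)
    have := le_pauliRayleigh_neg_one (m := -M) (M := -m) hh hR0 hΩ hψ.neg.c2 hψ.neg.lap_eq hR'
      (fun x hx => neg_le_neg (hM x hx)) (fun x hx => neg_le_neg (hm x hx)) hu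
    rwa [show -m - -M = M - m by ring] at this
  · filter_upwards [Ioo_mem_nhdsGT (show (0 : ℝ) < M - m by linarith)] with ε hε
    set U := connectedComponentIn Γᶜ x₀ with hU_def
    have hUo : IsOpen U := hΓ.isClosed.isOpen_compl.connectedComponentIn
    have hUΩ : U ⊆ Ω :=
      connectedComponentIn_compl_subset_of_isSimplyConnected hΩ hsc hΓ hΓΩ hx₀b
    have hcl : closure U ⊆ Ω := by
      rw [closure_eq_self_union_frontier]
      exact union_subset hUΩ
        ((frontier_connectedComponentIn_compl_subset hΓ.isClosed x₀).trans hΓΩ)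
    have hx₀U : x₀ ∈ U := mem_connectedComponentIn hx₀Γ
    let K := closure U ∩ ψ ⁻¹' Iic (M - ε / 2)
    have hK : IsCompact K := hx₀b.isCompact_closure.of_isClosed_subset
      ((hψ.c2.continuousOn.mono hcl).preimage_isClosed_of_isClosed isClosed_closure isClosed_Iic)
      inter_subset_left
    have hKU : K ⊆ U := fun x hx => by
      by_contra hxU
      have : x ∈ Γ := frontier_connectedComponentIn_compl_subset hΓ.isClosed x₀
        ⟨hx.1, by rwa [hUo.interior_eq]⟩
      have h2 : ψ x ≤ M - ε / 2 := hx.2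
      rw [hΓψ x this] at h2
      linarith [hε.1]
    obtain ⟨C, hC, hle⟩ := exists_lambdaMinusD_le (s := M - ε / 2) (t := m + ε / 2) (x₀ := x₀)
      hΩ hψ.c2 hψ.lap_eq hbdd hK hUo hKU hUΩ
      ⟨subset_closure hx₀U, by rw [mem_preimage, mem_Iic, hx₀ψ]; linarith [hε.1, hε.2]⟩
      (fun x hx => le_of_not_ge fun h' => hx.2 ⟨subset_closure hx.1, h'⟩)
      (by rw [hx₀ψ]; linarith [hε.1])
    refine ⟨C, hC, fun h hh => (min_le_left _ _).trans ((hle h hh).trans_eq ?_)⟩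
    rw [show M - ε / 2 - (m + ε / 2) = osc ψ Ω - ε by rw [osc]; ring]

/-- Theorem 2.7 / `thm-closed`: if `ψ_min < 0 < ψ_max` and one of the
extreme level sets of `ψ₀` contains a `C^{2,α}` simple closed curve enclosing a nonempty
part of the other extreme level set, then
`lim_{h→0⁺} h·log Λ^D(h,B,Ω) = −2·Osc_Ω ψ₀`. -/
theorem pauli_full_lim_of_enclosing_level_curve (Ω : Set (ℝ × ℝ)) (B ψ₀ : ℝ × ℝ → ℝ)
    (hR : AssumptionR Ω B) (hsc : SimplyConnectedSpace Ω)
    (hψ : IsScalarPotential Ω B ψ₀)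
    (hmin : sInf (ψ₀ '' Ω) < 0) (hmax : 0 < sSup (ψ₀ '' Ω))
    (hcurve : ∃ α > 0, ∃ Γ : Set (ℝ × ℝ), IsC2ClosedCurve α Γ ∧
      ((Γ ⊆ closure Ω ∩ ψ₀ ⁻¹' {sSup (ψ₀ '' Ω)} ∧
          (curveInterior Γ ∩ closure Ω ∩ ψ₀ ⁻¹' {sInf (ψ₀ '' Ω)}).Nonempty) ∨
       (Γ ⊆ closure Ω ∩ ψ₀ ⁻¹' {sInf (ψ₀ '' Ω)} ∧
          (curveInterior Γ ∩ closure Ω ∩ ψ₀ ⁻¹' {sSup (ψ₀ '' Ω)}).Nonempty))) :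
    Tendsto (fun h : ℝ => h * Real.log (LambdaD h (perpGrad ψ₀) B Ω)) (𝓝[>] 0)
      (𝓝 (-(2 * osc ψ₀ Ω))) := by
  obtain ⟨α, -, Γ, ⟨γ, -, hγ, -, rfl⟩, hΓ⟩ := hcurve
  have hc : IsCompact (γ '' Icc 0 1) := isCompact_Icc.image_of_continuousOn hγ.1.continuousOn
  rcases hΓ with ⟨hΓ, hne⟩ | ⟨hΓ, hne⟩
  · exact tendsto_log_LambdaD_of_maximal_level hR.isOpen hR.bounded hsc hψ hmin hmax hc hΓ hne
  · have himg : (-ψ₀) '' Ω = -(ψ₀ '' Ω) := by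
      rw [← image_neg_eq_neg, image_image]
      rfl
    have hinf : sInf ((-ψ₀) '' Ω) = -sSup (ψ₀ '' Ω) := by rw [himg, Real.sInf_def, neg_neg]
    have hsup : sSup ((-ψ₀) '' Ω) = -sInf (ψ₀ '' Ω) := by rw [himg, Real.sInf_def, neg_neg]
    have := tendsto_log_LambdaD_of_maximal_level hR.isOpen hR.bounded hsc hψ.neg
      (by rw [hinf]; linarith) (by rw [hsup]; linarith) hc
      (fun x hx => ⟨(hΓ hx).1, by
        rw [mem_preimage, mem_singleton_iff, hsup, Pi.neg_apply, (hΓ hx).2]⟩)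
      (hne.mono fun x hx => ⟨hx.1, by
        rw [mem_preimage, mem_singleton_iff, hinf, Pi.neg_apply, hx.2]⟩)
    have hosc : osc (-ψ₀) Ω = osc ψ₀ Ω := by rw [osc, osc, hinf, hsup]; ring
    simpa only [LambdaD_neg, hosc] using this
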